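/- arXiv:1210.3626 — 2 statements merged into one kernel-verified Lean document; each statement's English description precedes it below -/
import Mathlib

section
/- For every M > 0 there exist M' > M and C > 0 such that for all x ∈ ℝ and all t > 0: ∫_{-∞}^{∞} t^{−1/2} Σ_{j=1}^m exp(−(x−y−a_j t)²/(Mt)) · (1+|y|)^{−3/2} dy ≤ C (θ + ψ₁ + ψ₂)(x,t), where θ, ψ₁, ψ₂ are defined using the constant M'. -/
open MeasureTheory Real

/-- The Gaussian-weight sum `θ`. -/
noncomputable def theta (m : ℕ) (a : Fin m → ℝ) (M' : ℝ) (x t : ℝ) : ℝ :=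
  ∑ j : Fin m, (1 + t) ^ (-(1/2 : ℝ)) * Real.exp (-((x - a j * t) ^ 2 / (M' * t)))

/-- The indicator `χ` of the characteristic cone `[a₁ t, a_m t]`. -/
noncomputable def chi (a1 am x t : ℝ) : ℝ :=
  if a1 * t ≤ x ∧ x ≤ am * t then 1 else 0

/-- The algebraically decaying weight `ψ₁` supported inside the characteristic cone. -/
noncomputable def psi1 (m : ℕ) (a : Fin m → ℝ) (a1 am x t : ℝ) : ℝ :=
  chi a1 am x t *
    ∑ j : Fin m, (1 + |x| + t) ^ (-(1/2 : ℝ)) * (1 + |x - a j * t|) ^ (-(1/2 : ℝ))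

/-- The weight `ψ₂` supported outside the characteristic cone. -/
noncomputable def psi2 (a1 am x t : ℝ) : ℝ :=
  (1 - chi a1 am x t) *
    ((1 + |x - a1 * t| + Real.sqrt t) ^ (-(3/2 : ℝ)) +
      (1 + |x - am * t| + Real.sqrt t) ^ (-(3/2 : ℝ)))

/-- The unnormalised heat kernel with diffusion constant `b`. -/
noncomputable def heatKernel (b t y : ℝ) : ℝ :=
  t ^ (-(1/2 : ℝ)) * Real.exp (-(y ^ 2 / (b * t)))

lemma heatKernel_nonneg {t : ℝ} (ht : 0 < t) (b y : ℝ) : 0 ≤ heatKernel b t y := by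
  unfold heatKernel; positivity

lemma heatKernel_le {b t : ℝ} (hb : 0 < b) (ht : 0 < t) (y : ℝ) :
    heatKernel b t y ≤ t ^ (-(1/2 : ℝ)) := by
  unfold heatKernel
  refine mul_le_of_le_one_right (by positivity) (Real.exp_le_one_iff.2 ?_)
  have : 0 ≤ y ^ 2 / (b * t) := by positivity
  linarith

lemma heatKernel_eq (b t y : ℝ) :
    heatKernel b t y = t ^ (-(1/2 : ℝ)) * Real.exp (-(b * t)⁻¹ * y ^ 2) := by
  unfold heatKernel; congr 2; ring

lemma integrable_heatKernel_sub {b t : ℝ} (hb : 0 < b) (ht : 0 < t) (z : ℝ) :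
    Integrable fun y => heatKernel b t (z - y) := by
  have h : Integrable (heatKernel b t) := by
    simp_rw [funext (heatKernel_eq b t)]
    exact (integrable_exp_neg_mul_sq (inv_pos.2 (mul_pos hb ht))).const_mul _
  exact h.comp_sub_left z

lemma integral_heatKernel_sub {b t : ℝ} (ht : 0 < t) (z : ℝ) :
    ∫ y, heatKernel b t (z - y) = √(π * b) := by
  rw [integral_sub_left_eq_self (heatKernel b t) volume z]
  simp_rw [heatKernel_eq, integral_const_mul, integral_gaussian]
  rw [div_inv_eq_mul, ← mul_assoc, Real.sqrt_mul' _ ht.le, Real.sqrt_eq_rpow t, mul_left_comm,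
    ← Real.rpow_add ht]
  norm_num

lemma integrable_one_add_abs_rpow : Integrable fun y : ℝ => (1 + |y|) ^ (-(3/2 : ℝ)) := by
  have h := integrable_one_add_norm (E := ℝ) (μ := volume) (r := 3/2) (by norm_num)
  simpa using h

lemma one_add_abs_rpow_le_one (y : ℝ) : (1 + |y|) ^ (-(3/2 : ℝ)) ≤ 1 :=
  Real.rpow_le_one_of_one_le_of_nonpos (by linarith [abs_nonneg y]) (by norm_num)

lemma integrable_heatKernel_mul {b t : ℝ} (hb : 0 < b) (ht : 0 < t) (z : ℝ) :
    Integrable fun y => heatKernel b t (z - y) * (1 + |y|) ^ (-(3/2 : ℝ)) := by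
  refine (integrable_heatKernel_sub hb ht z).mul_bdd (c := 1)
    integrable_one_add_abs_rpow.aestronglyMeasurable (ae_of_all _ fun y => ?_)
  rw [Real.norm_of_nonneg (by positivity)]
  exact one_add_abs_rpow_le_one y

/-- Uniform-in-space decay of the heat flow of algebraically decaying data. -/
lemma integral_heatKernel_mul_le_of_time {b : ℝ} (hb : 0 < b) :
    ∃ C > 0, ∀ z t : ℝ, 0 < t →
      ∫ y, heatKernel b t (z - y) * (1 + |y|) ^ (-(3/2 : ℝ)) ≤ C * (1 + t) ^ (-(1/2 : ℝ)) := by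
  set W := ∫ y : ℝ, (1 + |y|) ^ (-(3/2 : ℝ)) with hW
  have hW0 : 0 ≤ W := integral_nonneg fun y => by positivity
  have hs : 0 < √(π * b) := by positivity
  refine ⟨2 ^ (1/2 : ℝ) * (W + √(π * b)), by positivity, fun z t ht => ?_⟩
  have hI := integrable_heatKernel_mul hb ht z
  have key : ∀ {A s : ℝ}, 0 ≤ A → 0 < s → A ≤ W + √(π * b) → (1 + t) / 2 ≤ s →
      A * s ^ (-(1/2 : ℝ)) ≤ 2 ^ (1/2 : ℝ) * (W + √(π * b)) * (1 + t) ^ (-(1/2 : ℝ)) := by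
    intro A s hA hs' hAW hst
    have h1 : s ^ (-(1/2 : ℝ)) ≤ ((1 + t) / 2) ^ (-(1/2 : ℝ)) :=
      Real.rpow_le_rpow_of_nonpos (by positivity) hst (by norm_num)
    have h3 : ((1 + t) / 2) ^ (-(1/2 : ℝ)) = 2 ^ (1/2 : ℝ) * (1 + t) ^ (-(1/2 : ℝ)) := by
      rw [Real.div_rpow (by positivity) (by positivity), Real.rpow_neg two_pos.le, div_inv_eq_mul,
        mul_comm]
    calc A * s ^ (-(1/2 : ℝ))
        ≤ (W + √(π * b)) * (2 ^ (1/2 : ℝ) * (1 + t) ^ (-(1/2 : ℝ))) := by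
          rw [← h3]; gcongr
      _ = _ := by ring
  rcases le_total 1 t with h | h
  · refine le_trans ?_ (key hW0 ht (by linarith) (by linarith))
    rw [hW, mul_comm, ← integral_const_mul]
    refine integral_mono hI (integrable_one_add_abs_rpow.const_mul _) fun y => ?_
    exact mul_le_mul_of_nonneg_right (heatKernel_le hb ht _) (by positivity)
  · refine le_trans ?_ (key (s := 1) hs.le one_pos (by linarith) (by linarith))
    rw [Real.one_rpow, mul_one, ← integral_heatKernel_sub ht z]
    exact integral_mono hI (integrable_heatKernel_sub hb ht z) fun y =>
      mul_le_of_le_one_right (heatKernel_nonneg ht _ _) (one_add_abs_rpow_le_one y)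

/-- Near the data the kernel is Gaussian in `z`; far away the data decay algebraically in `z`. -/
lemma heatKernel_mul_le_split {M t : ℝ} (hM : 0 < M) (ht : 0 < t) (z y : ℝ) :
    heatKernel M t (z - y) * (1 + |y|) ^ (-(3/2 : ℝ)) ≤
      Real.exp (-(z ^ 2 / (8 * M * t))) *
          (heatKernel (2 * M) t (z - y) * (1 + |y|) ^ (-(3/2 : ℝ))) +
        heatKernel M t (z - y) * (1 + |z| / 2) ^ (-(3/2 : ℝ)) := by
  have hM0 := heatKernel_nonneg ht M (z - y)
  have h2M0 := heatKernel_nonneg ht (2 * M) (z - y)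
  rcases le_total (|z| / 2) |y| with h | h
  · refine le_add_of_nonneg_of_le (by positivity) (mul_le_mul_of_nonneg_left ?_ hM0)
    exact Real.rpow_le_rpow_of_nonpos (by positivity) (by linarith) (by norm_num)
  · refine le_add_of_le_of_nonneg ?_ (by positivity)
    rw [← mul_assoc]
    refine mul_le_mul_of_nonneg_right ?_ (by positivity)
    unfold heatKernel
    rw [mul_left_comm, ← Real.exp_add]
    gcongr
    have h1 : z ^ 2 / 4 ≤ (z - y) ^ 2 := by
      have : |z| / 2 ≤ |z - y| := by linarith [abs_sub_abs_le_abs_sub z y]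
      have := pow_le_pow_left₀ (by positivity) this 2
      rw [div_pow, sq_abs, sq_abs] at this
      linarith
    have h3 : (z - y) ^ 2 / (M * t) - (z ^ 2 / (8 * M * t) + (z - y) ^ 2 / (2 * M * t)) =
        ((z - y) ^ 2 - z ^ 2 / 4) / (2 * M * t) := by field_simp; ring
    have h4 : 0 ≤ ((z - y) ^ 2 - z ^ 2 / 4) / (2 * M * t) :=
      div_nonneg (by linarith) (by positivity)
    linarith

lemma integral_heatKernel_mul_le {M : ℝ} (hM : 0 < M) :
    ∃ C > 0, ∀ z t : ℝ, 0 < t →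
      ∫ y, heatKernel M t (z - y) * (1 + |y|) ^ (-(3/2 : ℝ)) ≤
        C * ((1 + t) ^ (-(1/2 : ℝ)) * Real.exp (-(z ^ 2 / (8 * M * t))) +
          (1 + |z| + √t) ^ (-(3/2 : ℝ))) := by
  obtain ⟨C₁, hC₁, h₁⟩ := integral_heatKernel_mul_le_of_time hM
  obtain ⟨C₂, hC₂, h₂⟩ := integral_heatKernel_mul_le_of_time (b := 2 * M) (by positivity)
  refine ⟨C₁ * Real.exp (1 / (8 * M)) + C₂ + √(π * M) * 8, by positivity, fun z t ht => ?_⟩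
  set E := Real.exp (-(z ^ 2 / (8 * M * t)))
  set T := (1 + t) ^ (-(1/2 : ℝ))
  set D := (1 + |z| + √t) ^ (-(3/2 : ℝ))
  have hE : 0 < E := Real.exp_pos _
  have hT : 0 < T := by positivity
  have hD : 0 < D := by positivity
  rcases le_total |z| √t with h | h
  · have hz : z ^ 2 ≤ t := by
      have := pow_le_pow_left₀ (abs_nonneg z) h 2
      rwa [sq_abs, Real.sq_sqrt ht.le] at this
    have h1 : 1 ≤ Real.exp (1 / (8 * M)) * E := by
      rw [← Real.exp_add, Real.one_le_exp_iff]
      have : z ^ 2 / (8 * M * t) ≤ 1 / (8 * M) := by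
        rw [div_le_div_iff₀ (by positivity) (by positivity)]
        nlinarith
      linarith
    calc _ ≤ C₁ * T := h₁ z t ht
      _ ≤ C₁ * T * (Real.exp (1 / (8 * M)) * E) := le_mul_of_one_le_right (by positivity) h1
      _ = C₁ * Real.exp (1 / (8 * M)) * (T * E) := by ring
      _ ≤ _ := by
        gcongr
        · linarith [show 0 < √(π * M) * 8 by positivity]
        · linarith
  · have hfar : (1 + |z| / 2) ^ (-(3/2 : ℝ)) ≤ 8 * D := by
      have h4 : (4 : ℝ) ^ (-(3/2 : ℝ)) = 8⁻¹ := by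
        rw [show (4 : ℝ) = 2 ^ (2 : ℝ) by norm_num, ← Real.rpow_mul two_pos.le]
        norm_num
      have h5 : (4 * (1 + |z| / 2)) ^ (-(3/2 : ℝ)) ≤ D :=
        Real.rpow_le_rpow_of_nonpos (by positivity) (by linarith [abs_nonneg z]) (by norm_num)
      rw [Real.mul_rpow (by norm_num) (by positivity), h4] at h5
      linarith
    have hI₂ := (integrable_heatKernel_mul (b := 2 * M) (by positivity) ht z).const_mul E
    have hI := (integrable_heatKernel_sub hM ht z).mul_const ((1 + |z| / 2) ^ (-(3/2 : ℝ)))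
    calc _ ≤ ∫ y, (E * (heatKernel (2 * M) t (z - y) * (1 + |y|) ^ (-(3/2 : ℝ))) +
            heatKernel M t (z - y) * (1 + |z| / 2) ^ (-(3/2 : ℝ))) :=
          integral_mono (integrable_heatKernel_mul hM ht z) (hI₂.add hI)
            fun y => heatKernel_mul_le_split hM ht z y
      _ = E * (∫ y, heatKernel (2 * M) t (z - y) * (1 + |y|) ^ (-(3/2 : ℝ))) +
            √(π * M) * (1 + |z| / 2) ^ (-(3/2 : ℝ)) := by
          rw [integral_add hI₂ hI, integral_const_mul, integral_mul_const,
            integral_heatKernel_sub ht]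
      _ ≤ E * (C₂ * T) + √(π * M) * (8 * D) := by
          gcongr
          exact h₂ z t ht
      _ = C₂ * (T * E) + √(π * M) * 8 * D := by ring
      _ ≤ _ := by
          have e1 : 0 ≤ C₁ * Real.exp (1 / (8 * M)) * (T * E + D) := by positivity
          have e2 : 0 ≤ C₂ * D := by positivity
          have e3 : 0 ≤ √(π * M) * 8 * (T * E) := by positivity
          linarith

/-- The algebraic tail around an intermediate characteristic is controlled by `ψ₁ + ψ₂`. -/
lemma tail_le_psi {m : ℕ} {a : Fin m → ℝ} {a1 am : ℝ} (h1 : ∀ j, a1 ≤ a j) (hm : ∀ j, a j ≤ am)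
    (j : Fin m) {x t : ℝ} (ht : 0 < t) :
    (1 + |x - a j * t| + √t) ^ (-(3/2 : ℝ)) ≤
      (1 + |a1| + |am|) ^ (1/2 : ℝ) * (psi1 m a a1 am x t + psi2 a1 am x t) := by
  set K := 1 + |a1| + |am| with hK
  have hK1 : 1 ≤ K := by linarith [abs_nonneg a1, abs_nonneg am]
  have hKr : 1 ≤ K ^ (1/2 : ℝ) := Real.one_le_rpow hK1 (by norm_num)
  have hst := Real.sqrt_nonneg t
  unfold psi1 psi2 chi
  split_ifs with hx
  · set z := x - a j * t
    have hxK : 1 + |x| + t ≤ K * (1 + t) := by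
      have : |x| ≤ (|a1| + |am|) * t := by
        rw [abs_le]
        constructor <;> nlinarith [neg_abs_le a1, le_abs_self am, abs_nonneg a1, abs_nonneg am]
      nlinarith [abs_nonneg a1, abs_nonneg am]
    have hz := abs_nonneg z
    have e1 : (1 + |z| + √t) ^ (-1 : ℝ) ≤ (1 + t) ^ (-(1/2 : ℝ)) := by
      rw [show (-1 : ℝ) = 2 * (-(1/2)) by norm_num, Real.rpow_mul (by positivity)]
      refine Real.rpow_le_rpow_of_nonpos (by positivity) ?_ (by norm_num)
      rw [Real.rpow_two]
      nlinarith [Real.sq_sqrt ht.le]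
    have e2 : (1 + t) ^ (-(1/2 : ℝ)) ≤ K ^ (1/2 : ℝ) * (1 + |x| + t) ^ (-(1/2 : ℝ)) := by
      have := Real.rpow_le_rpow_of_nonpos (z := -(1/2 : ℝ)) (by positivity) hxK (by norm_num)
      rw [Real.mul_rpow (by positivity) (by positivity)] at this
      calc (1 + t) ^ (-(1/2 : ℝ))
          = K ^ (1/2 : ℝ) * (K ^ (-(1/2 : ℝ)) * (1 + t) ^ (-(1/2 : ℝ))) := by
            rw [← mul_assoc, ← Real.rpow_add (by positivity)]; norm_num
        _ ≤ _ := by gcongr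
    have e3 : (1 + |z| + √t) ^ (-(1/2 : ℝ)) ≤ (1 + |z|) ^ (-(1/2 : ℝ)) :=
      Real.rpow_le_rpow_of_nonpos (by positivity) (by linarith) (by norm_num)
    have e4 := Finset.single_le_sum
      (f := fun j => (1 + |x| + t) ^ (-(1/2 : ℝ)) * (1 + |x - a j * t|) ^ (-(1/2 : ℝ)))
      (fun i _ => by positivity) (Finset.mem_univ j)
    rw [sub_self, zero_mul, add_zero, one_mul]
    calc (1 + |z| + √t) ^ (-(3/2 : ℝ))
        = (1 + |z| + √t) ^ (-1 : ℝ) * (1 + |z| + √t) ^ (-(1/2 : ℝ)) := by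
          rw [← Real.rpow_add (by positivity)]; norm_num
      _ ≤ K ^ (1/2 : ℝ) * (1 + |x| + t) ^ (-(1/2 : ℝ)) * (1 + |z|) ^ (-(1/2 : ℝ)) :=
          mul_le_mul (e1.trans e2) e3 (by positivity) (by positivity)
      _ ≤ _ := by
          rw [mul_assoc]; gcongr
  · have p1 : 0 ≤ (1 + |x - a1 * t| + √t) ^ (-(3/2 : ℝ)) := by positivity
    have pm : 0 ≤ (1 + |x - am * t| + √t) ^ (-(3/2 : ℝ)) := by positivity
    have g1 := mul_le_mul_of_nonneg_right (h1 j) ht.le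
    have gm := mul_le_mul_of_nonneg_right (hm j) ht.le
    rw [zero_mul, zero_add, sub_zero, one_mul]
    refine le_trans ?_ (le_mul_of_one_le_left (by positivity) hKr)
    rcases lt_or_ge x (a1 * t) with h | h
    · refine le_add_of_le_of_nonneg ?_ pm
      refine Real.rpow_le_rpow_of_nonpos (by positivity) ?_ (by norm_num)
      rw [abs_of_nonpos (by linarith), abs_of_nonpos (by linarith)]
      linarith
    · have h' : am * t < x := not_le.1 fun h' => hx ⟨h, h'⟩
      refine le_add_of_nonneg_of_le p1 ?_
      refine Real.rpow_le_rpow_of_nonpos (by positivity) ?_ (by norm_num)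
      rw [abs_of_nonneg (by linarith), abs_of_nonneg (by linarith)]
      linarith

/-- The linear estimate: the Green-function bound applied to algebraically
decaying initial data is dominated by `θ + ψ₁ + ψ₂`. -/
theorem linear_estimate (m : ℕ) (hm : 2 ≤ m) (a : Fin m → ℝ) (ha : StrictMono a)
    (M : ℝ) (hM : 0 < M) :
    ∃ M' > M, ∃ C > 0, ∀ x t : ℝ, 0 < t →
      (∫ y : ℝ, t ^ (-(1/2 : ℝ)) *
          (∑ j : Fin m, Real.exp (-((x - y - a j * t) ^ 2 / (M * t)))) *
          (1 + |y|) ^ (-(3/2 : ℝ)))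
        ≤ C * (theta m a M' x t +
            psi1 m a (a ⟨0, by omega⟩) (a ⟨m - 1, by omega⟩) x t +
            psi2 (a ⟨0, by omega⟩) (a ⟨m - 1, by omega⟩) x t) := by
  obtain ⟨C, hC, hle⟩ := integral_heatKernel_mul_le hM
  set a1 := a ⟨0, by omega⟩
  set am := a ⟨m - 1, by omega⟩
  have h1 : ∀ j, a1 ≤ a j := fun j => ha.monotone (Nat.zero_le _)
  have hm' : ∀ j, a j ≤ am := fun j => ha.monotone (Fin.le_def.2 (Nat.le_sub_one_of_lt j.2))
  set K := (1 + |a1| + |am|) ^ (1/2 : ℝ)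
  have hK : 0 < K := by positivity
  refine ⟨8 * M, by linarith, C * (1 + m * K), by positivity, fun x t ht => ?_⟩
  have hθ : 0 ≤ theta m a (8 * M) x t := Finset.sum_nonneg fun j _ => by positivity
  have hψ : 0 ≤ psi1 m a a1 am x t + psi2 a1 am x t := by
    have := (Real.rpow_nonneg (by positivity) _).trans (tail_le_psi h1 hm' ⟨0, by omega⟩ (x := x) ht)
    exact nonneg_of_mul_nonneg_right this hK
  calc (∫ y : ℝ, t ^ (-(1/2 : ℝ)) *
          (∑ j : Fin m, Real.exp (-((x - y - a j * t) ^ 2 / (M * t)))) *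
          (1 + |y|) ^ (-(3/2 : ℝ)))
      = ∫ y : ℝ, ∑ j : Fin m,
          heatKernel M t (x - a j * t - y) * (1 + |y|) ^ (-(3/2 : ℝ)) := by
        simp_rw [Finset.mul_sum, Finset.sum_mul, heatKernel, sub_right_comm x]
    _ = ∑ j : Fin m, ∫ y : ℝ,
          heatKernel M t (x - a j * t - y) * (1 + |y|) ^ (-(3/2 : ℝ)) :=
        integral_finsetSum _ fun j _ => integrable_heatKernel_mul hM ht _
    _ ≤ ∑ j : Fin m, C * ((1 + t) ^ (-(1/2 : ℝ)) *
          Real.exp (-((x - a j * t) ^ 2 / (8 * M * t))) +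
          K * (psi1 m a a1 am x t + psi2 a1 am x t)) := by
        refine Finset.sum_le_sum fun j _ => (hle _ t ht).trans ?_
        gcongr
        exact tail_le_psi h1 hm' j ht
    _ = C * (theta m a (8 * M) x t + m * K * (psi1 m a a1 am x t + psi2 a1 am x t)) := by
        rw [← Finset.mul_sum, Finset.sum_add_distrib, Finset.sum_const, Finset.card_univ,
          Fintype.card_fin, nsmul_eq_mul, theta]
        ring
    _ ≤ _ := by
        rw [mul_assoc C]
        refine mul_le_mul_of_nonneg_left ?_ hC.le
        have e1 : 0 ≤ m * K * theta m a (8 * M) x t := by positivity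
        nlinarith
end

section
/- Assume additionally a₁ ≤ 0 ≤ a_m. For every M > 0 there exist M' > M and C > 0 such that, with θ, ψ₁, ψ₂ defined using the constant M', for all x ∈ ℝ and all t > 0: ∫₀^t ∫_{-∞}^{∞} (t−s)^{−1} Σ_{j=1}^m exp(−(x−y−a_j(t−s))²/(M(t−s))) · θ(y,s)² dy ds ≤ C (θ + ψ₁ + ψ₂)(x,t). -/
open MeasureTheory Real intervalIntegral

open Set

lemma rpow_neg_half_eq_inv_sqrt {x : ℝ} (hx : 0 ≤ x) : x ^ (-(1/2 : ℝ)) = (√x)⁻¹ := by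
  rw [Real.rpow_neg hx, ← Real.sqrt_eq_rpow]

lemma intervalIntegrable_inv_sqrt (a b : ℝ) (ha : 0 ≤ a) (hb : 0 ≤ b) :
    IntervalIntegrable (fun s : ℝ => (√s)⁻¹) volume a b := by
  have h := intervalIntegral.intervalIntegrable_rpow' (a := a) (b := b) (r := -(1/2 : ℝ))
    (by norm_num)
  refine h.congr fun s hs => ?_
  exact rpow_neg_half_eq_inv_sqrt ((le_min ha hb).trans hs.1.le)

lemma integral_inv_sqrt {b : ℝ} (hb : 0 ≤ b) : ∫ s in (0 : ℝ)..b, (√s)⁻¹ = 2 * √b := by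
  have h := integral_rpow (a := 0) (b := b) (r := -(1/2 : ℝ)) (Or.inl (by norm_num))
  rw [← intervalIntegral.integral_congr (f := fun s : ℝ => s ^ (-(1/2 : ℝ))), h,
    Real.sqrt_eq_rpow, Real.zero_rpow (by norm_num)]
  · norm_num
    ring
  · intro s hs
    rw [uIcc_of_le hb] at hs
    exact rpow_neg_half_eq_inv_sqrt hs.1

lemma integral_exp_neg_sq_mul_exp_neg_sq {p q : ℝ} (hp : 0 < p) (hq : 0 < q) (u v : ℝ) :
    Integrable (fun y : ℝ => Real.exp (-((u - y) ^ 2 / p)) * Real.exp (-((y - v) ^ 2 / q))) ∧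
    ∫ y : ℝ, Real.exp (-((u - y) ^ 2 / p)) * Real.exp (-((y - v) ^ 2 / q)) =
      √(Real.pi * (p * q / (p + q))) * Real.exp (-((u - v) ^ 2 / (p + q))) := by
  have hpq : 0 < (p + q) / (p * q) := by positivity
  have key : (fun y : ℝ => Real.exp (-((u - y) ^ 2 / p)) * Real.exp (-((y - v) ^ 2 / q))) =
      fun y : ℝ => Real.exp (-((p + q) / (p * q)) * (y - (u * q + v * p) / (p + q)) ^ 2) *
        Real.exp (-((u - v) ^ 2 / (p + q))) := by
    funext y
    rw [← Real.exp_add, ← Real.exp_add]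
    congr 1
    have : p + q ≠ 0 := by positivity
    field_simp
    ring
  have hi := (integrable_exp_neg_mul_sq hpq).comp_sub_right ((u * q + v * p) / (p + q))
  rw [key]
  refine ⟨hi.mul_const _, ?_⟩
  rw [MeasureTheory.integral_mul_const, integral_sub_right_eq_self
    (fun y : ℝ => Real.exp (-((p + q) / (p * q)) * y ^ 2)), integral_gaussian]
  congr 3
  field_simp

lemma mul_exp_neg_sq_div_le {κ b t : ℝ} (hκ : 0 < κ) (ht : 0 < t) :
    b * Real.exp (-(κ * b ^ 2 / t)) ≤ √(t / κ) := by
  have hz : (b / √(t / κ)) ^ 2 = κ * b ^ 2 / t := by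
    rw [div_pow, Real.sq_sqrt (by positivity)]
    field_simp
  have hs : 0 < √(t / κ) := by positivity
  rw [← hz, Real.exp_neg, ← div_eq_mul_inv, div_le_iff₀ (Real.exp_pos _)]
  have h1 := Real.add_one_le_exp ((b / √(t / κ)) ^ 2)
  have h2 : b = √(t / κ) * (b / √(t / κ)) := by field_simp
  nth_rw 1 [h2]
  gcongr
  nlinarith [sq_nonneg (b / √(t / κ) - 1), sq_nonneg (b / √(t / κ))]

lemma intervalIntegrable_inv_sqrt_mul {t : ℝ} (ht : 0 ≤ t) {f : ℝ → ℝ} (hf : Continuous f) :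
    IntervalIntegrable (fun s => (√s)⁻¹ * f s) volume 0 t :=
  (intervalIntegrable_inv_sqrt 0 t le_rfl ht).mul_continuousOn hf.continuousOn

lemma intervalIntegrable_inv_sqrt_sub_mul {t : ℝ} (ht : 0 ≤ t) {f : ℝ → ℝ} (hf : Continuous f) :
    IntervalIntegrable (fun s => (√(t - s))⁻¹ * f s) volume 0 t := by
  have h := (intervalIntegrable_inv_sqrt 0 t le_rfl ht).comp_sub_left t
  simp only [sub_zero, sub_self] at h
  exact h.symm.mul_continuousOn hf.continuousOn

lemma exists_integral_inv_sqrt_mul_gaussian_le {κ : ℝ} (hκ : 0 < κ) :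
    ∃ C > 0, ∀ t > 0, ∀ s₀ : ℝ,
      ∫ s in (0 : ℝ)..t, (√s)⁻¹ * Real.exp (-(κ * (s - s₀) ^ 2 / t)) ≤
        C * √t * (√(1 + |s₀|))⁻¹ := by
  refine ⟨4 + 2 * (√(Real.pi / κ) + 2 * √(1 / κ)), by positivity, fun t ht s₀ => ?_⟩
  have hint := intervalIntegrable_inv_sqrt_mul ht.le (f := fun s =>
    Real.exp (-(κ * (s - s₀) ^ 2 / t))) (by fun_prop)
  rcases le_or_gt |s₀| 1 with h | h
  · have h1 : ∫ s in (0 : ℝ)..t, (√s)⁻¹ * Real.exp (-(κ * (s - s₀) ^ 2 / t)) ≤ 2 * √t := by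
      rw [← integral_inv_sqrt ht.le]
      refine intervalIntegral.integral_mono_on ht.le hint
        (intervalIntegrable_inv_sqrt 0 t le_rfl ht.le) fun s _ => ?_
      refine mul_le_of_le_one_right (by positivity) (Real.exp_le_one_iff.2 ?_)
      have : 0 ≤ κ * (s - s₀) ^ 2 / t := by positivity
      linarith
    have h2 : √(1 + |s₀|) ≤ 2 := by
      rw [Real.sqrt_le_left (by norm_num)]; linarith
    have h3 : 1 ≤ 2 * (√(1 + |s₀|))⁻¹ := by
      rw [← div_eq_mul_inv, le_div_iff₀ (by positivity)]; linarith
    calc _ ≤ 2 * √t := h1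
      _ ≤ 2 * √t * (2 * (√(1 + |s₀|))⁻¹) := le_mul_of_one_le_right (by positivity) h3
      _ = 4 * √t * (√(1 + |s₀|))⁻¹ := by ring
      _ ≤ _ := by gcongr; exact le_add_of_nonneg_right (by positivity)
  · set b := |s₀| / 2 with hb
    have hb0 : 0 < b := by positivity
    have hgauss : (fun s : ℝ => Real.exp (-(κ * (s - s₀) ^ 2 / t))) =
        fun s => Real.exp (-(κ / t) * (s - s₀) ^ 2) := by
      funext s; congr 1; ring
    have hgi : Integrable (fun s : ℝ => Real.exp (-(κ * (s - s₀) ^ 2 / t))) := by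
      rw [hgauss]
      exact (integrable_exp_neg_mul_sq (by positivity)).comp_sub_right s₀
    have hgv : ∫ s : ℝ, Real.exp (-(κ * (s - s₀) ^ 2 / t)) = √(Real.pi / κ) * √t := by
      rw [hgauss, integral_sub_right_eq_self (fun s : ℝ => Real.exp (-(κ / t) * s ^ 2)),
        integral_gaussian, ← Real.sqrt_mul (by positivity)]
      congr 1
      field_simp
    have hii : Integrable ((Ioc 0 b).indicator fun s : ℝ => (√s)⁻¹) := by
      rw [integrable_indicator_iff measurableSet_Ioc]
      exact (intervalIntegrable_iff_integrableOn_Ioc_of_le hb0.le).1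
        (intervalIntegrable_inv_sqrt 0 b le_rfl hb0.le)
    have hiv : ∫ s, (Ioc 0 b).indicator (fun s : ℝ => (√s)⁻¹) s = 2 * √b := by
      rw [MeasureTheory.integral_indicator measurableSet_Ioc, ← intervalIntegral.integral_of_le hb0.le,
        integral_inv_sqrt hb0.le]
    have hi0 : ∀ s, 0 ≤ (Ioc 0 b).indicator (fun s : ℝ => (√s)⁻¹) s :=
      fun s => indicator_nonneg (fun _ _ => by positivity) s
    have hmain : ∫ s in (0 : ℝ)..t, (√s)⁻¹ * Real.exp (-(κ * (s - s₀) ^ 2 / t)) ≤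
        (√b)⁻¹ * (√(Real.pi / κ) * √t) + Real.exp (-(κ * b ^ 2 / t)) * (2 * √b) := by
      rw [intervalIntegral.integral_of_le ht.le, ← hgv, ← hiv,
        ← MeasureTheory.integral_const_mul, ← MeasureTheory.integral_const_mul,
        ← integral_add (hgi.const_mul _) (hii.const_mul _)]
      have hsum := (hgi.const_mul (√b)⁻¹).add (hii.const_mul (Real.exp (-(κ * b ^ 2 / t))))
      refine le_trans ?_ (setIntegral_le_integral (s := Ioc 0 t) hsum ?_)
      · refine setIntegral_mono_on
          ((intervalIntegrable_iff_integrableOn_Ioc_of_le ht.le).1 hint) hsum.integrableOn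
          measurableSet_Ioc fun s hs => ?_
        rcases le_or_gt s b with hsb | hsb
        · rw [indicator_of_mem (show s ∈ Ioc 0 b from ⟨hs.1, hsb⟩), mul_comm (√s)⁻¹]
          refine le_trans ?_ (le_add_of_nonneg_left (by positivity))
          have habs : b ≤ |s - s₀| := by
            have := abs_sub_abs_le_abs_sub s₀ s
            rw [abs_sub_comm, abs_of_pos hs.1] at this
            linarith
          have hsq : b ^ 2 ≤ (s - s₀) ^ 2 := by
            rw [← sq_abs (s - s₀)]; gcongr
          gcongr
        · refine le_trans ?_ (le_add_of_nonneg_right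
            (mul_nonneg (Real.exp_pos _).le (hi0 s)))
          gcongr
      · refine Filter.Eventually.of_forall fun s => ?_
        exact add_nonneg (by positivity) (mul_nonneg (Real.exp_pos _).le (hi0 s))
    have h2 : (√b)⁻¹ ≤ 2 * (√(1 + |s₀|))⁻¹ := by
      rw [← div_eq_mul_inv, inv_le_comm₀ (by positivity) (by positivity), inv_div,
        div_le_iff₀ (by norm_num), Real.sqrt_le_left (by positivity), mul_pow,
        Real.sq_sqrt hb0.le]
      linarith
    have h3 : Real.exp (-(κ * b ^ 2 / t)) * (2 * √b) ≤ (√b)⁻¹ * (2 * √(1 / κ) * √t) := by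
      have h4 := mul_exp_neg_sq_div_le (b := b) hκ ht
      have h5 : √(t / κ) = √(1 / κ) * √t := by
        rw [← Real.sqrt_mul (by positivity)]; congr 1; ring
      have h6 : √b = (√b)⁻¹ * b := by
        rw [inv_mul_eq_div, Real.div_sqrt]
      calc _ = (√b)⁻¹ * (2 * (b * Real.exp (-(κ * b ^ 2 / t)))) := by
            nth_rw 1 [h6]; ring
        _ ≤ (√b)⁻¹ * (2 * √(t / κ)) := by gcongr
        _ = _ := by rw [h5]; ring
    calc _ ≤ (√b)⁻¹ * ((√(Real.pi / κ) + 2 * √(1 / κ)) * √t) := by linarith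
      _ ≤ 2 * (√(1 + |s₀|))⁻¹ * ((√(Real.pi / κ) + 2 * √(1 / κ)) * √t) := by gcongr
      _ = 2 * (√(Real.pi / κ) + 2 * √(1 / κ)) * √t * (√(1 + |s₀|))⁻¹ := by ring
      _ ≤ _ := by gcongr; exact le_add_of_nonneg_left (by norm_num)

/-- The Gaussian produced by the `y`-integration of a kernel term moving with speed `α` against
a Gaussian moving with speed `β`, with its singular weight in `s`. -/
noncomputable def weightedGaussian (M α β x t s : ℝ) : ℝ :=
  (√s)⁻¹ * Real.exp (-((x - α * (t - s) - β * s) ^ 2 / (M * t))) +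
    (√(t - s))⁻¹ * Real.exp (-((x - α * (t - s) - β * s) ^ 2 / (M * t)))

lemma weightedGaussian_nonneg (M α β x t s : ℝ) : 0 ≤ weightedGaussian M α β x t s := by
  unfold weightedGaussian
  positivity

lemma intervalIntegrable_sum {ι : Type*} {s : Finset ι} {f : ι → ℝ → ℝ} {b c : ℝ}
    (h : ∀ i ∈ s, IntervalIntegrable (f i) volume b c) :
    IntervalIntegrable (fun x => ∑ i ∈ s, f i x) volume b c := by
  simpa only [Finset.sum_fn] using IntervalIntegrable.sum s h

lemma intervalIntegrable_weightedGaussian (M α β x : ℝ) {t : ℝ} (ht : 0 ≤ t) :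
    IntervalIntegrable (weightedGaussian M α β x t) volume 0 t :=
  (intervalIntegrable_inv_sqrt_mul ht (by fun_prop)).add
    (intervalIntegrable_inv_sqrt_sub_mul ht (by fun_prop))

lemma integral_weightedGaussian_le_of_le {M α β x t E : ℝ} (ht : 0 < t)
    (hE : ∀ s, 0 ≤ s → s ≤ t → Real.exp (-((x - α * (t - s) - β * s) ^ 2 / (M * t))) ≤ E) :
    ∫ s in (0 : ℝ)..t, weightedGaussian M α β x t s ≤ 4 * √t * E := by
  have h1 : IntervalIntegrable (fun s => (√s)⁻¹ * E) volume 0 t :=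
    intervalIntegrable_inv_sqrt_mul ht.le continuous_const
  have h2 : IntervalIntegrable (fun s => (√(t - s))⁻¹ * E) volume 0 t :=
    intervalIntegrable_inv_sqrt_sub_mul ht.le continuous_const
  calc _ ≤ ∫ s in (0 : ℝ)..t, ((√s)⁻¹ * E + (√(t - s))⁻¹ * E) := by
        refine intervalIntegral.integral_mono_on ht.le
          (intervalIntegrable_weightedGaussian M α β x ht.le) (h1.add h2) fun s hs => ?_
        have := hE s hs.1 hs.2
        unfold weightedGaussian
        gcongr
    _ = 4 * √t * E := by
        rw [intervalIntegral.integral_add h1 h2, intervalIntegral.integral_mul_const,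
          intervalIntegral.integral_mul_const,
          intervalIntegral.integral_comp_sub_left (fun s => (√s)⁻¹), sub_self, sub_zero,
          integral_inv_sqrt ht.le]
        ring

lemma inv_sqrt_one_add_abs_div_le {c z : ℝ} (hc : c ≠ 0) :
    (√(1 + |z / c|))⁻¹ ≤ √(1 + |c|) * (√(1 + |z|))⁻¹ := by
  have h0 : 0 < |c| := abs_pos.2 hc
  rw [← div_eq_mul_inv, inv_le_comm₀ (by positivity) (by positivity), inv_div,
    div_le_iff₀ (by positivity), ← Real.sqrt_mul (by positivity)]
  refine Real.sqrt_le_sqrt ?_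
  have h1 : |z| = |z / c| * |c| := by rw [abs_div]; field_simp
  nlinarith [abs_nonneg (z / c)]

lemma exists_integral_weightedGaussian_le {M α β : ℝ} (hM : 0 < M) (hαβ : α ≠ β) :
    ∃ C > 0, ∀ t > 0, ∀ x : ℝ,
      ∫ s in (0 : ℝ)..t, weightedGaussian M α β x t s ≤
        C * √t * ((√(1 + |x - α * t|))⁻¹ + (√(1 + |x - β * t|))⁻¹) := by
  have hc : β - α ≠ 0 := sub_ne_zero.2 hαβ.symm
  have hκ : 0 < (β - α) ^ 2 / M := by positivity
  obtain ⟨C, hC, hbound⟩ := exists_integral_inv_sqrt_mul_gaussian_le hκ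
  refine ⟨C * √(1 + |β - α|), by positivity, fun t ht x => ?_⟩
  set s₀ := (x - α * t) / (β - α) with hs₀
  have hexp : ∀ s, Real.exp (-((x - α * (t - s) - β * s) ^ 2 / (M * t))) =
      Real.exp (-((β - α) ^ 2 / M * (s - s₀) ^ 2 / t)) := by
    intro s
    have : x - α * (t - s) - β * s = (β - α) * (s₀ - s) := by
      rw [hs₀]; field_simp; ring
    rw [this]
    congr 1
    field_simp
    ring
  have h2s : t - s₀ = -((x - β * t) / (β - α)) := by
    rw [hs₀]; field_simp; ring
  have hb1 := hbound t ht s₀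
  have hb2 := hbound t ht (t - s₀)
  have hrefl : ∫ s in (0 : ℝ)..t,
      (√(t - s))⁻¹ * Real.exp (-((β - α) ^ 2 / M * (s - s₀) ^ 2 / t)) =
      ∫ s in (0 : ℝ)..t,
        (√s)⁻¹ * Real.exp (-((β - α) ^ 2 / M * (s - (t - s₀)) ^ 2 / t)) := by
    have := intervalIntegral.integral_comp_sub_left (a := 0) (b := t) (fun s =>
      (√s)⁻¹ * Real.exp (-((β - α) ^ 2 / M * (s - (t - s₀)) ^ 2 / t))) t
    rw [sub_self, sub_zero] at this
    rw [← this]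
    refine intervalIntegral.integral_congr fun s _ => ?_
    congr 4
    ring
  have hi1 := inv_sqrt_one_add_abs_div_le (z := x - α * t) hc
  have hi2 := inv_sqrt_one_add_abs_div_le (z := x - β * t) hc
  rw [← hs₀] at hi1
  rw [h2s, abs_neg, ← h2s] at hb2
  simp only [weightedGaussian, hexp]
  rw [intervalIntegral.integral_add (intervalIntegrable_inv_sqrt_mul ht.le (by fun_prop))
    (intervalIntegrable_inv_sqrt_sub_mul ht.le (by fun_prop)), hrefl]
  calc _ ≤ C * √t * (√(1 + |s₀|))⁻¹ + C * √t * (√(1 + |(x - β * t) / (β - α)|))⁻¹ :=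
        add_le_add hb1 hb2
    _ ≤ C * √t * (√(1 + |β - α|) * (√(1 + |x - α * t|))⁻¹) +
        C * √t * (√(1 + |β - α|) * (√(1 + |x - β * t|))⁻¹) := by gcongr
    _ = _ := by ring

lemma inv_mul_inv_mul_sqrt_le {s t : ℝ} (hs : 0 < s) (hst : s < t) :
    (t - s)⁻¹ * (1 + s)⁻¹ * √((t - s) * s / t) ≤ (1 + t)⁻¹ * ((√s)⁻¹ + (√(t - s))⁻¹) := by
  have ht : 0 < t := hs.trans hst
  have hts : 0 < t - s := sub_pos.2 hst
  rw [Real.sqrt_div (by positivity), Real.sqrt_mul hts.le]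
  obtain ⟨p, hp, hp2⟩ : ∃ p, 0 < p ∧ p = √s := ⟨_, by positivity, rfl⟩
  obtain ⟨q, hq, hq2⟩ : ∃ q, 0 < q ∧ q = √(t - s) := ⟨_, by positivity, rfl⟩
  obtain ⟨r, hr, hr2⟩ : ∃ r, 0 < r ∧ r = √t := ⟨_, by positivity, rfl⟩
  have hsp : s = p ^ 2 := by rw [hp2, Real.sq_sqrt hs.le]
  have hsq : t - s = q ^ 2 := by rw [hq2, Real.sq_sqrt hts.le]
  have hsr : t = r ^ 2 := by rw [hr2, Real.sq_sqrt ht.le]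
  rw [← hp2, ← hq2, ← hr2, hsq, hsp, hsr]
  have hpqr : r ^ 2 = p ^ 2 + q ^ 2 := by linarith
  have hr_le : r ≤ p + q := by
    refine le_of_sq_le_sq ?_ (by positivity)
    nlinarith [mul_pos hp hq]
  have hL : (q ^ 2)⁻¹ * (1 + p ^ 2)⁻¹ * (q * p / r) = p / (q * (1 + p ^ 2) * r) := by
    field_simp
  have hR : (1 + r ^ 2)⁻¹ * (p⁻¹ + q⁻¹) = (p + q) / ((1 + r ^ 2) * (p * q)) := by
    field_simp
    ring
  rw [hL, hR, div_le_div_iff₀ (by positivity) (by positivity)]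
  have h1 : p ^ 2 * (1 + r ^ 2) ≤ (p + q) * r * (1 + p ^ 2) := by
    have h3 : p ^ 2 * (1 + r ^ 2) ≤ r * r * (1 + p ^ 2) := by nlinarith [sq_nonneg q]
    exact h3.trans (by gcongr)
  nlinarith [mul_le_mul_of_nonneg_left h1 hq.le]

lemma theta_sq_le (m : ℕ) (a : Fin m → ℝ) {M s : ℝ} (y : ℝ) (hs : 0 < s) :
    theta m a (2 * M) y s ^ 2 ≤
      m * (1 + s)⁻¹ * ∑ k : Fin m, Real.exp (-((y - a k * s) ^ 2 / (M * s))) := by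
  have h := sq_sum_le_card_mul_sum_sq (s := Finset.univ)
    (f := fun k : Fin m => (1 + s) ^ (-(1/2 : ℝ)) *
      Real.exp (-((y - a k * s) ^ 2 / (2 * M * s))))
  unfold theta
  refine h.trans_eq ?_
  rw [Finset.card_univ, Fintype.card_fin, mul_assoc (m : ℝ)]
  congr 1
  rw [Finset.mul_sum]
  refine Finset.sum_congr rfl fun k _ => ?_
  rw [mul_pow, rpow_neg_half_eq_inv_sqrt (by positivity), inv_pow, Real.sq_sqrt (by positivity),
    ← Real.exp_nat_mul]
  congr 2
  push_cast
  rw [mul_assoc 2 M s, mul_neg, ← mul_div_assoc, mul_div_mul_left _ _ two_ne_zero]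

lemma integral_kernel_mul_theta_sq_le (m : ℕ) (a : Fin m → ℝ) {M s t : ℝ} (hM : 0 < M) (x : ℝ)
    (hs : 0 < s) (hst : s < t) :
    ∫ y : ℝ, (t - s)⁻¹ *
        (∑ j : Fin m, Real.exp (-((x - y - a j * (t - s)) ^ 2 / (M * (t - s))))) *
        (theta m a (2 * M) y s) ^ 2 ≤
      m * √(Real.pi * M) * (1 + t)⁻¹ *
        ∑ j : Fin m, ∑ k : Fin m, weightedGaussian M (a j) (a k) x t s := by
  have hts : 0 < t - s := sub_pos.2 hst
  have ht : 0 < t := hs.trans hst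
  have hconv := fun j k : Fin m => integral_exp_neg_sq_mul_exp_neg_sq (p := M * (t - s))
    (q := M * s) (by positivity) (by positivity) (x - a j * (t - s)) (a k * s)
  have hadd : M * (t - s) + M * s = M * t := by ring
  have hpq : ∀ j k : Fin m, √(Real.pi * (M * (t - s) * (M * s) / (M * t))) =
      √(Real.pi * M) * √((t - s) * s / t) := by
    intro j k
    rw [← Real.sqrt_mul (by positivity)]
    congr 1
    field_simp
  have hint : Integrable fun y : ℝ => (t - s)⁻¹ * (m * (1 + s)⁻¹) * ∑ j : Fin m, ∑ k : Fin m,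
      Real.exp (-((x - a j * (t - s) - y) ^ 2 / (M * (t - s)))) *
        Real.exp (-((y - a k * s) ^ 2 / (M * s))) :=
    (integrable_finsetSum _ fun j _ => integrable_finsetSum _ fun k _ =>
      (hconv j k).1).const_mul _
  calc _ ≤ ∫ y : ℝ, (t - s)⁻¹ * (m * (1 + s)⁻¹) * ∑ j : Fin m, ∑ k : Fin m,
        Real.exp (-((x - a j * (t - s) - y) ^ 2 / (M * (t - s)))) *
          Real.exp (-((y - a k * s) ^ 2 / (M * s))) := by
        refine integral_mono_of_nonneg (Filter.Eventually.of_forall fun y => ?_) hint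
          (Filter.Eventually.of_forall fun y => ?_)
        · simp only [Pi.zero_apply]
          positivity
        · have h := theta_sq_le m a (M := M) y hs
          simp only
          calc _ ≤ (t - s)⁻¹ *
              (∑ j : Fin m, Real.exp (-((x - y - a j * (t - s)) ^ 2 / (M * (t - s))))) *
              (m * (1 + s)⁻¹ * ∑ k : Fin m, Real.exp (-((y - a k * s) ^ 2 / (M * s)))) := by
                gcongr
            _ = (t - s)⁻¹ * (m * (1 + s)⁻¹) *
              ((∑ j : Fin m, Real.exp (-((x - y - a j * (t - s)) ^ 2 / (M * (t - s))))) *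
                ∑ k : Fin m, Real.exp (-((y - a k * s) ^ 2 / (M * s)))) := by ring
            _ = _ := by
                rw [Finset.sum_mul_sum]
                simp only [sub_right_comm x y]
    _ = (t - s)⁻¹ * (m * (1 + s)⁻¹) * ∑ j : Fin m, ∑ k : Fin m,
        √(Real.pi * M) * √((t - s) * s / t) *
          Real.exp (-((x - a j * (t - s) - a k * s) ^ 2 / (M * t))) := by
        rw [MeasureTheory.integral_const_mul, MeasureTheory.integral_finsetSum _ fun j _ =>
          integrable_finsetSum _ fun k _ => (hconv j k).1]
        congr 1
        refine Finset.sum_congr rfl fun j _ => ?_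
        rw [MeasureTheory.integral_finsetSum _ fun k _ => (hconv j k).1]
        refine Finset.sum_congr rfl fun k _ => ?_
        rw [(hconv j k).2, hadd, hpq j k]
    _ ≤ _ := by
        simp only [Finset.mul_sum]
        refine Finset.sum_le_sum fun j _ => Finset.sum_le_sum fun k _ => ?_
        set E := Real.exp (-((x - a j * (t - s) - a k * s) ^ 2 / (M * t))) with hE
        calc _ = m * √(Real.pi * M) * E * ((t - s)⁻¹ * (1 + s)⁻¹ * √((t - s) * s / t)) := by ring
          _ ≤ m * √(Real.pi * M) * E * ((1 + t)⁻¹ * ((√s)⁻¹ + (√(t - s))⁻¹)) :=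
            mul_le_mul_of_nonneg_left (inv_mul_inv_mul_sqrt_le hs hst) (by positivity)
          _ = _ := by rw [weightedGaussian, ← hE]; ring

lemma theta_nonneg (m : ℕ) (a : Fin m → ℝ) (M' x : ℝ) {t : ℝ} (ht : 0 < t) :
    0 ≤ theta m a M' x t := by
  unfold theta
  positivity

lemma chi_nonneg (a1 am x t : ℝ) : 0 ≤ chi a1 am x t := by
  unfold chi
  split_ifs <;> norm_num

lemma chi_le_one (a1 am x t : ℝ) : chi a1 am x t ≤ 1 := by
  unfold chi
  split_ifs <;> norm_num

lemma psi1_nonneg (m : ℕ) (a : Fin m → ℝ) (a1 am x : ℝ) {t : ℝ} (ht : 0 < t) :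
    0 ≤ psi1 m a a1 am x t := by
  unfold psi1
  exact mul_nonneg (chi_nonneg _ _ _ _) (by positivity)

lemma psi2_nonneg (a1 am x t : ℝ) : 0 ≤ psi2 a1 am x t := by
  unfold psi2
  exact mul_nonneg (sub_nonneg.2 (chi_le_one _ _ _ _)) (by positivity)

lemma exp_le_sqrt_mul_theta (m : ℕ) (a : Fin m → ℝ) {M x t : ℝ} (hM : 0 < M) (ht : 0 < t)
    (l : Fin m) :
    Real.exp (-((x - a l * t) ^ 2 / (M * t))) ≤ √(1 + t) * theta m a (2 * M) x t := by
  have h1 : (1 + t) ^ (-(1/2 : ℝ)) * Real.exp (-((x - a l * t) ^ 2 / (2 * M * t))) ≤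
      theta m a (2 * M) x t :=
    Finset.single_le_sum (f := fun j => (1 + t) ^ (-(1/2 : ℝ)) *
      Real.exp (-((x - a j * t) ^ 2 / (2 * M * t)))) (fun j _ => by positivity)
      (Finset.mem_univ l)
  rw [rpow_neg_half_eq_inv_sqrt (by positivity), inv_mul_le_iff₀ (by positivity)] at h1
  refine le_trans ?_ h1
  gcongr
  linarith

lemma sqrt_mul_sqrt_one_add_le {t : ℝ} (ht : 0 < t) : √t * √(1 + t) ≤ 1 + t := by
  calc √t * √(1 + t) ≤ √(1 + t) * √(1 + t) := by gcongr; linarith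
    _ = 1 + t := Real.mul_self_sqrt (by positivity)

lemma integral_weightedGaussian_le_theta (m : ℕ) (a : Fin m → ℝ) {M α β x t : ℝ} (hM : 0 < M)
    (ht : 0 < t) (l : Fin m)
    (h : ∀ s, 0 ≤ s → s ≤ t → (x - a l * t) ^ 2 ≤ (x - α * (t - s) - β * s) ^ 2) :
    ∫ s in (0 : ℝ)..t, weightedGaussian M α β x t s ≤ 4 * (1 + t) * theta m a (2 * M) x t := by
  refine (integral_weightedGaussian_le_of_le ht (E := √(1 + t) * theta m a (2 * M) x t)
    fun s hs hst => le_trans ?_ (exp_le_sqrt_mul_theta m a hM ht l)).trans ?_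
  · have := h s hs hst
    gcongr
  · have h1 := sqrt_mul_sqrt_one_add_le ht
    have h2 := theta_nonneg m a (2 * M) x ht
    calc _ = 4 * (√t * √(1 + t)) * theta m a (2 * M) x t := by ring
      _ ≤ _ := by gcongr

lemma inv_sqrt_add_inv_sqrt_le_psi1 (m : ℕ) (a : Fin m → ℝ) {a1 am x t : ℝ} (ht : 0 < t)
    (hx : a1 * t ≤ x ∧ x ≤ am * t) (j k : Fin m) :
    (√(1 + |x - a j * t|))⁻¹ + (√(1 + |x - a k * t|))⁻¹ ≤
      2 * √(1 + |a1| + |am|) * √(1 + t) * psi1 m a a1 am x t := by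
  have hterm : ∀ l : Fin m, (√(1 + |x - a l * t|))⁻¹ ≤
      √(1 + |a1| + |am|) * √(1 + t) * psi1 m a a1 am x t := by
    intro l
    have h1 : (1 + |x| + t) ^ (-(1/2 : ℝ)) * (1 + |x - a l * t|) ^ (-(1/2 : ℝ)) ≤
        psi1 m a a1 am x t := by
      rw [psi1, chi, if_pos hx, one_mul]
      exact Finset.single_le_sum (f := fun j => (1 + |x| + t) ^ (-(1/2 : ℝ)) *
        (1 + |x - a j * t|) ^ (-(1/2 : ℝ))) (fun j _ => by positivity) (Finset.mem_univ l)
    rw [rpow_neg_half_eq_inv_sqrt (by positivity), rpow_neg_half_eq_inv_sqrt (by positivity),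
      inv_mul_le_iff₀ (by positivity)] at h1
    refine h1.trans ?_
    have h0 := psi1_nonneg m a a1 am x ht
    gcongr
    rw [← Real.sqrt_mul (by positivity)]
    refine Real.sqrt_le_sqrt ?_
    have hax : |x| ≤ (|a1| + |am|) * t := by
      rw [abs_le]
      constructor
      · nlinarith [neg_abs_le a1, abs_nonneg am]
      · nlinarith [le_abs_self am, abs_nonneg a1]
    nlinarith [abs_nonneg a1, abs_nonneg am]
  linarith [hterm j, hterm k]

lemma exists_integral_weightedGaussian_le_weights (m : ℕ) (a : Fin m → ℝ) {M : ℝ} (hM : 0 < M)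
    {l₁ l₂ : Fin m} (hl₁ : ∀ j, a l₁ ≤ a j) (hl₂ : ∀ j, a j ≤ a l₂) (j k : Fin m) :
    ∃ C > 0, ∀ x t : ℝ, 0 < t →
      ∫ s in (0 : ℝ)..t, weightedGaussian M (a j) (a k) x t s ≤
        C * (1 + t) * (theta m a (2 * M) x t + psi1 m a (a l₁) (a l₂) x t +
          psi2 (a l₁) (a l₂) x t) := by
  have hsolve : ∃ D > 0, ∀ x t : ℝ, 0 < t → a j ≠ a k →
      ∫ s in (0 : ℝ)..t, weightedGaussian M (a j) (a k) x t s ≤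
        D * √t * ((√(1 + |x - a j * t|))⁻¹ + (√(1 + |x - a k * t|))⁻¹) := by
    by_cases hjk : a j = a k
    · exact ⟨1, one_pos, fun _ _ _ h => absurd hjk h⟩
    · obtain ⟨D, hD, h⟩ := exists_integral_weightedGaussian_le hM hjk
      exact ⟨D, hD, fun x t ht _ => h t ht x⟩
  obtain ⟨D, hD, hbound⟩ := hsolve
  refine ⟨4 + D * (2 * √(1 + |a l₁| + |a l₂|)), by positivity, fun x t ht => ?_⟩
  have hθ := theta_nonneg m a (2 * M) x ht
  have hψ₁ := psi1_nonneg m a (a l₁) (a l₂) x ht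
  have hψ₂ := psi2_nonneg (a l₁) (a l₂) x t
  have of_theta : (∃ l : Fin m, ∀ s, 0 ≤ s → s ≤ t →
      (x - a l * t) ^ 2 ≤ (x - a j * (t - s) - a k * s) ^ 2) →
      ∫ s in (0 : ℝ)..t, weightedGaussian M (a j) (a k) x t s ≤
        (4 + D * (2 * √(1 + |a l₁| + |a l₂|))) * (1 + t) * (theta m a (2 * M) x t +
          psi1 m a (a l₁) (a l₂) x t + psi2 (a l₁) (a l₂) x t) := by
    rintro ⟨l, hl⟩
    refine (integral_weightedGaussian_le_theta m a hM ht l hl).trans ?_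
    gcongr
    · exact le_add_of_nonneg_right (by positivity)
    · linarith
  by_cases hjk : a j = a k
  · refine of_theta ⟨j, fun s _ _ => le_of_eq ?_⟩
    rw [hjk]
    ring
  by_cases hx : a l₁ * t ≤ x ∧ x ≤ a l₂ * t
  · calc _ ≤ D * √t * ((√(1 + |x - a j * t|))⁻¹ + (√(1 + |x - a k * t|))⁻¹) :=
          hbound x t ht hjk
      _ ≤ D * √t * (2 * √(1 + |a l₁| + |a l₂|) * √(1 + t) * psi1 m a (a l₁) (a l₂) x t) := by
          gcongr
          exact inv_sqrt_add_inv_sqrt_le_psi1 m a ht hx j k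
      _ = D * (2 * √(1 + |a l₁| + |a l₂|)) * (√t * √(1 + t)) * psi1 m a (a l₁) (a l₂) x t := by
          ring
      _ ≤ _ := by
          have := sqrt_mul_sqrt_one_add_le ht
          gcongr
          · exact le_add_of_nonneg_left (by norm_num)
          · linarith
  · rcases lt_or_ge x (a l₁ * t) with h1 | h1
    · refine of_theta ⟨l₁, fun s hs hst => ?_⟩
      have e1 := mul_le_mul_of_nonneg_right (hl₁ j) (sub_nonneg.2 hst)
      have e2 := mul_le_mul_of_nonneg_right (hl₁ k) hs
      nlinarith
    · have h2 : a l₂ * t < x := not_le.1 fun h => hx ⟨h1, h⟩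
      refine of_theta ⟨l₂, fun s hs hst => ?_⟩
      have e1 := mul_le_mul_of_nonneg_right (hl₂ j) (sub_nonneg.2 hst)
      have e2 := mul_le_mul_of_nonneg_right (hl₂ k) hs
      nlinarith

/-- Nonlinear interaction estimate for the Gaussian part `θ²`. -/
theorem nonlinear_estimate_theta (m : ℕ) (hm : 2 ≤ m) (a : Fin m → ℝ) (ha : StrictMono a)
    (ha1 : a ⟨0, by omega⟩ ≤ 0) (ham : 0 ≤ a ⟨m - 1, by omega⟩)
    (M : ℝ) (hM : 0 < M) :
    ∃ M' > M, ∃ C > 0, ∀ x t : ℝ, 0 < t →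
      (∫ s in (0 : ℝ)..t, ∫ y : ℝ, (t - s)⁻¹ *
          (∑ j : Fin m, Real.exp (-((x - y - a j * (t - s)) ^ 2 / (M * (t - s))))) *
          (theta m a M' y s) ^ 2)
        ≤ C * (theta m a M' x t +
            psi1 m a (a ⟨0, by omega⟩) (a ⟨m - 1, by omega⟩) x t +
            psi2 (a ⟨0, by omega⟩) (a ⟨m - 1, by omega⟩) x t) := by
  have hl₁ : ∀ j, a ⟨0, by omega⟩ ≤ a j := fun j => ha.monotone (Fin.mk_le_of_le_val (Nat.zero_le _))
  have hl₂ : ∀ j, a j ≤ a ⟨m - 1, by omega⟩ := fun j =>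
    ha.monotone (Fin.le_def.2 (Nat.le_sub_one_of_lt j.2))
  choose C hC hbound using fun j k =>
    exists_integral_weightedGaussian_le_weights m a hM hl₁ hl₂ j k
  have hCs : 0 ≤ ∑ j, ∑ k, C j k :=
    Finset.sum_nonneg fun j _ => Finset.sum_nonneg fun k _ => (hC j k).le
  refine ⟨2 * M, by linarith, m * √(Real.pi * M) * (∑ j, ∑ k, C j k) + 1, by positivity,
    fun x t ht => ?_⟩
  have hR : 0 ≤ theta m a (2 * M) x t +
      psi1 m a (a ⟨0, by omega⟩) (a ⟨m - 1, by omega⟩) x t +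
      psi2 (a ⟨0, by omega⟩) (a ⟨m - 1, by omega⟩) x t :=
    add_nonneg (add_nonneg (theta_nonneg _ _ _ _ ht) (psi1_nonneg _ _ _ _ _ ht))
      (psi2_nonneg _ _ _ _)
  set R := theta m a (2 * M) x t +
      psi1 m a (a ⟨0, by omega⟩) (a ⟨m - 1, by omega⟩) x t +
      psi2 (a ⟨0, by omega⟩) (a ⟨m - 1, by omega⟩) x t
  have hG : IntervalIntegrable (fun s => m * √(Real.pi * M) * (1 + t)⁻¹ *
      ∑ j : Fin m, ∑ k : Fin m, weightedGaussian M (a j) (a k) x t s) volume 0 t := by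
    refine IntervalIntegrable.const_mul ?_ _
    exact intervalIntegrable_sum fun j _ => intervalIntegrable_sum fun k _ =>
      intervalIntegrable_weightedGaussian M (a j) (a k) x ht.le
  calc _ ≤ ∫ s in (0 : ℝ)..t, m * √(Real.pi * M) * (1 + t)⁻¹ *
        ∑ j : Fin m, ∑ k : Fin m, weightedGaussian M (a j) (a k) x t s := by
        rw [intervalIntegral.integral_of_le ht.le, intervalIntegral.integral_of_le ht.le,
          integral_Ioc_eq_integral_Ioo, integral_Ioc_eq_integral_Ioo]
        refine integral_mono_of_nonneg ?_
          ((intervalIntegrable_iff_integrableOn_Ioo_of_le ht.le).1 hG) ?_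
        · refine (ae_restrict_iff' measurableSet_Ioo).2 (Filter.Eventually.of_forall
            fun s hs => integral_nonneg fun y => ?_)
          have := sub_pos.2 hs.2
          simp only [Pi.zero_apply]
          positivity
        · exact (ae_restrict_iff' measurableSet_Ioo).2 (Filter.Eventually.of_forall
            fun s hs => integral_kernel_mul_theta_sq_le m a hM x hs.1 hs.2)
    _ = m * √(Real.pi * M) * (1 + t)⁻¹ * ∑ j : Fin m, ∑ k : Fin m,
        ∫ s in (0 : ℝ)..t, weightedGaussian M (a j) (a k) x t s := by
        have hi := fun j k : Fin m => intervalIntegrable_weightedGaussian M (a j) (a k) x ht.le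
        rw [intervalIntegral.integral_const_mul, intervalIntegral.integral_finsetSum
          fun j _ => intervalIntegrable_sum fun k _ => hi j k]
        congr 1
        exact Finset.sum_congr rfl fun j _ =>
          intervalIntegral.integral_finsetSum fun k _ => hi j k
    _ ≤ m * √(Real.pi * M) * (1 + t)⁻¹ * ∑ j : Fin m, ∑ k : Fin m, C j k * (1 + t) * R := by
        gcongr with j _ k _
        exact hbound j k x t ht
    _ = m * √(Real.pi * M) * (∑ j, ∑ k, C j k) * R := by
        simp only [← Finset.sum_mul]
        field_simp
    _ ≤ _ := by
        gcongr
        linarith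
end
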